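/- Let k ∈ ℕ. The k-AOU space M_k(ℂ) (with unit I_k and cone the positive semidefinite matrices in M_k(M_k(ℂ)) ≅ M_{k²}(ℂ)) is injective in the category of k-AOU spaces: whenever ι: V → W is a unital k-order embedding of k-AOU spaces and φ: V → M_k(ℂ) is a unital k-positive map, there exists a unital k-positive map φ̃: W → M_k(ℂ) with φ̃ ∘ ι = φ. -/

import Mathlib

open scoped ComplexConjugate ComplexOrder

noncomputable section

universe u v

/-- The diagonal matrix `I_n ⊗ e` in `M_n(V)`. -/
def unitMat {V : Type u} [AddCommGroup V] (n : ℕ) (e : V) : Matrix (Fin n) (Fin n) V :=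
  Matrix.of fun i j => if i = j then e else 0

/-- The conjugation `α* x α ∈ M_m(V)` of `x ∈ M_n(V)` by a scalar matrix `α ∈ M_{n,m}(ℂ)`. -/
def conjAct {V : Type u} [AddCommGroup V] [Module ℂ V] {n m : ℕ}
    (α : Matrix (Fin n) (Fin m) ℂ) (x : Matrix (Fin n) (Fin n) V) :
    Matrix (Fin m) (Fin m) V :=
  Matrix.of fun i j => ∑ p : Fin n, ∑ q : Fin n, (conj (α p i) * α q j) • x p q

section Defs

variable {V : Type u} [AddCommGroup V] [Module ℂ V] [StarAddMonoid V] [StarModule ℂ V]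

/-- `(V, C, e)` is a `k`-AOU space. -/
structure IsKAOU (k : ℕ) (C : Set (Matrix (Fin k) (Fin k) V)) (e : V) : Prop where
  herm : ∀ x ∈ C, star x = x
  add_mem : ∀ x ∈ C, ∀ y ∈ C, x + y ∈ C
  smul_mem : ∀ r : ℝ, 0 ≤ r → ∀ x ∈ C, (r : ℂ) • x ∈ C
  proper : ∀ x ∈ C, -x ∈ C → x = 0
  compat : ∀ α : Matrix (Fin k) (Fin k) ℂ, ∀ x ∈ C, conjAct α x ∈ C
  orderUnit : ∀ x : Matrix (Fin k) (Fin k) V, star x = x →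
    ∃ r : ℝ, 0 < r ∧ (r : ℂ) • unitMat k e - x ∈ C
  arch : ∀ x : Matrix (Fin k) (Fin k) V,
    (∀ r : ℝ, 0 < r → x + (r : ℂ) • unitMat k e ∈ C) → x ∈ C

/-- A matrix ordering on the `*`-vector space `V`. -/
structure IsMatrixOrdering (C : ∀ n : ℕ, Set (Matrix (Fin n) (Fin n) V)) : Prop where
  herm : ∀ n, ∀ x ∈ C n, star x = x
  add_mem : ∀ n, ∀ x ∈ C n, ∀ y ∈ C n, x + y ∈ C n
  smul_mem : ∀ n, ∀ r : ℝ, 0 ≤ r → ∀ x ∈ C n, (r : ℂ) • x ∈ C n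
  proper : ∀ n, ∀ x ∈ C n, -x ∈ C n → x = 0
  compat : ∀ n m : ℕ, ∀ α : Matrix (Fin n) (Fin m) ℂ, ∀ x ∈ C n, conjAct α x ∈ C m

/-- `(V, {C_n}, e)` is an (abstract) operator system. -/
structure IsOperatorSystem (C : ∀ n : ℕ, Set (Matrix (Fin n) (Fin n) V)) (e : V)
    extends IsMatrixOrdering C : Prop where
  orderUnit : ∀ n : ℕ, ∀ x : Matrix (Fin n) (Fin n) V, star x = x →
    ∃ r : ℝ, 0 < r ∧ (r : ℂ) • unitMat n e - x ∈ C n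
  arch : ∀ n : ℕ, ∀ x : Matrix (Fin n) (Fin n) V,
    (∀ r : ℝ, 0 < r → x + (r : ℂ) • unitMat n e ∈ C n) → x ∈ C n

/-- The cones `C_n^{k-min}` associated to a `k`-AOU space `(V, C, e)`. -/
def kMinCone (k : ℕ) (C : Set (Matrix (Fin k) (Fin k) V)) (n : ℕ) :
    Set (Matrix (Fin n) (Fin n) V) :=
  {x | star x = x ∧ ∀ α : Matrix (Fin n) (Fin k) ℂ, conjAct α x ∈ C}

/-- `{𝒞_n}` is an extension of the `k`-AOU space `(V, C, e)`: a matrix ordering with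
`𝒞_k = C` making `(V, {𝒞_n}, e)` an operator system. -/
def IsExtension (k : ℕ) (C : Set (Matrix (Fin k) (Fin k) V)) (e : V)
    (𝒞 : ∀ n : ℕ, Set (Matrix (Fin n) (Fin n) V)) : Prop :=
  IsOperatorSystem 𝒞 e ∧ 𝒞 k = C

end Defs

/-- Bundled data of a `k`-AOU space: a `*`-vector space with a distinguished subset of
`M_k(carrier)` and a distinguished element. -/
structure KAOUData (k : ℕ) : Type (u + 1) where
  carrier : Type u
  [addCommGroup : AddCommGroup carrier]
  [module : Module ℂ carrier]
  [starAddMonoid : StarAddMonoid carrier]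
  [starModule : StarModule ℂ carrier]
  cone : Set (Matrix (Fin k) (Fin k) carrier)
  unit : carrier

attribute [instance] KAOUData.addCommGroup KAOUData.module KAOUData.starAddMonoid
  KAOUData.starModule

/-- The bundled data is a `k`-AOU space. -/
def KAOUData.IsK {k : ℕ} (A : KAOUData.{u} k) : Prop := IsKAOU k A.cone A.unit

/-- `φ` is a unital `k`-positive map between (the data of) `k`-AOU spaces. -/
def UKPos {k : ℕ} (A : KAOUData.{u} k) (B : KAOUData.{v} k)
    (φ : A.carrier →ₗ[ℂ] B.carrier) : Prop :=
  φ A.unit = B.unit ∧ ∀ x ∈ A.cone, x.map ⇑φ ∈ B.cone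

/-- `φ` is a unital `k`-order embedding between (the data of) `k`-AOU spaces. -/
def UKOrderEmb {k : ℕ} (A : KAOUData.{u} k) (B : KAOUData.{v} k)
    (φ : A.carrier →ₗ[ℂ] B.carrier) : Prop :=
  UKPos A B φ ∧ Function.Injective φ ∧
    ∀ x : Matrix (Fin k) (Fin k) A.carrier, x.map ⇑φ ∈ B.cone → x ∈ A.cone

/-- Bundled data of an operator system: a `*`-vector space with a family of distinguished
matricial subsets and a distinguished element. -/
structure OSData : Type (u + 1) where
  carrier : Type u
  [addCommGroup : AddCommGroup carrier]
  [module : Module ℂ carrier]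
  [starAddMonoid : StarAddMonoid carrier]
  [starModule : StarModule ℂ carrier]
  cones : ∀ n : ℕ, Set (Matrix (Fin n) (Fin n) carrier)
  unit : carrier

attribute [instance] OSData.addCommGroup OSData.module OSData.starAddMonoid OSData.starModule

/-- The bundled data is an operator system. -/
def OSData.IsOS (A : OSData.{u}) : Prop := IsOperatorSystem A.cones A.unit

/-- `φ` is a unital completely positive map between (the data of) operator systems. -/
def UCP (A : OSData.{u}) (B : OSData.{v}) (φ : A.carrier →ₗ[ℂ] B.carrier) : Prop :=
  φ A.unit = B.unit ∧ ∀ n : ℕ, ∀ x ∈ A.cones n, x.map ⇑φ ∈ B.cones n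

/-- `φ` is a unital complete order embedding between (the data of) operator systems. -/
def UCOrderEmb (A : OSData.{u}) (B : OSData.{v}) (φ : A.carrier →ₗ[ℂ] B.carrier) : Prop :=
  UCP A B φ ∧ Function.Injective φ ∧
    ∀ (n : ℕ) (x : Matrix (Fin n) (Fin n) A.carrier), x.map ⇑φ ∈ B.cones n → x ∈ A.cones n

/-- `A` is `k`-minimal as an operator system. -/
def OSData.kMinimal (A : OSData.{u}) (k : ℕ) : Prop :=
  ∀ n : ℕ, A.cones n = kMinCone k (A.cones k) n

/-- Flatten a matrix of matrices `M_n(M_k(ℂ))` into a matrix `M_{nk}(ℂ)`. -/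
def flattenM {n k : ℕ} (x : Matrix (Fin n) (Fin n) (Matrix (Fin k) (Fin k) ℂ)) :
    Matrix (Fin n × Fin k) (Fin n × Fin k) ℂ :=
  Matrix.of fun p q => x p.1 q.1 p.2 q.2

/-- `M_k(ℂ)` as a `k`-AOU space: the unit is `I_k` and the cone consists of the elements of
`M_k(M_k(ℂ)) ≅ M_{k²}(ℂ)` that are positive semidefinite. -/
def MkData (k : ℕ) : KAOUData.{0} k where
  carrier := Matrix (Fin k) (Fin k) ℂ
  cone := {x | (flattenM x).PosSemidef}
  unit := 1

/-- A linear map sending each element of `C` to a self-adjoint element preserves the involution,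
provided that every self-adjoint element is a difference of elements of `C`. -/
lemma LinearMap.map_star_of_cone {E : Type*} {F : Type*}
    [AddCommGroup E] [Module ℂ E] [StarAddMonoid E] [StarModule ℂ E]
    [AddCommGroup F] [Module ℂ F] [StarAddMonoid F] [StarModule ℂ F]
    {C : Set E} (hC : ∀ x : E, star x = x → ∃ a ∈ C, ∃ b ∈ C, x = a - b)
    (T : E →ₗ[ℂ] F) (hT : ∀ x ∈ C, star (T x) = T x) (x : E) :
    T (star x) = star (T x) := by
  have key : ∀ y : E, star y = y → star (T y) = T y := by
    intro y hy
    obtain ⟨a, ha, b, hb, rfl⟩ := hC y hy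
    rw [map_sub, star_sub, hT a ha, hT b hb]
  have hre := key (realPart x) (realPart x).2
  have him := key (imaginaryPart x) (imaginaryPart x).2
  have hre' : star (realPart x : E) = realPart x := (realPart x).2
  have him' : star (imaginaryPart x : E) = imaginaryPart x := (imaginaryPart x).2
  rw [← realPart_add_I_smul_imaginaryPart x]
  simp only [star_add, star_smul, map_add, map_smul, hre, him, hre', him']

/-- A positive functional on an ordered `*`-vector space extends along an order embedding into a
`*`-vector space in which the image of `u` is an order unit. -/
lemma exists_positive_extension {E : Type*} {F : Type*}
    [AddCommGroup E] [Module ℂ E] [StarAddMonoid E] [StarModule ℂ E]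
    [AddCommGroup F] [Module ℂ F] [StarAddMonoid F] [StarModule ℂ F]
    {C : Set E} {D : Set F} {u : E} (hu : star u = u)
    (hD_star : ∀ x ∈ D, star x = x)
    (hD_add : ∀ x ∈ D, ∀ y ∈ D, x + y ∈ D)
    (hD_smul : ∀ r : ℝ, 0 ≤ r → ∀ x ∈ D, (r : ℂ) • x ∈ D)
    (T : E →ₗ[ℂ] F) (hT_inj : Function.Injective T)
    (hT_star : ∀ x, T (star x) = star (T x)) (hT : ∀ x, T x ∈ D → x ∈ C)
    (hD_unit : ∀ y : F, star y = y → ∃ r : ℝ, (r : ℂ) • T u - y ∈ D)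
    (s : E →ₗ[ℂ] ℂ) (hs_star : ∀ x, s (star x) = star (s x)) (hs : ∀ x ∈ C, 0 ≤ s x) :
    ∃ G : F →ₗ[ℂ] ℂ, (∀ x, G (T x) = s x) ∧ ∀ x ∈ D, 0 ≤ G x := by
  have hD_zero : (0 : F) ∈ D := by
    obtain ⟨r, hr⟩ := hD_unit 0 (star_zero _)
    simpa using hD_smul 0 le_rfl _ hr
  let P : PointedCone ℝ F :=
    { carrier := {x | x + star x ∈ D}
      add_mem' := by
        intro x y hx hy
        have := hD_add _ hx _ hy
        simp only [Set.mem_ofPred_eq, star_add]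
        convert this using 1
        abel
      zero_mem' := by simpa using hD_zero
      smul_mem' := by
        intro c x hx
        have := hD_smul c.1 c.2 _ hx
        change (c.1 : ℝ) • x + star ((c.1 : ℝ) • x) ∈ D
        rw [← Complex.coe_smul, star_smul, Complex.star_def, Complex.conj_ofReal, ← smul_add]
        exact this }
  let TR : E →ₗ[ℝ] F := T.restrictScalars ℝ
  let e := LinearEquiv.ofInjective TR hT_inj
  let f : F →ₗ.[ℝ] ℝ :=
    ⟨LinearMap.range TR, (Complex.reLm ∘ₗ s.restrictScalars ℝ) ∘ₗ e.symm.toLinearMap⟩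
  have hf : ∀ x : E, f (e x) = (s x).re := by
    intro x
    change (s (e.symm (e x))).re = _
    rw [e.symm_apply_apply]
  obtain ⟨g, hgf, hgP⟩ := riesz_extension P f (by
    intro y hy
    obtain ⟨x, rfl⟩ := e.surjective y
    rw [hf]
    have hy' : T x + star (T x) ∈ D := hy
    rw [← hT_star, ← map_add] at hy'
    have := (Complex.le_def.1 (hs _ (hT _ hy'))).1
    rw [map_add, hs_star] at this
    simp at this
    linarith) (by
    intro y
    obtain ⟨r, hr⟩ := hD_unit (-(y + star y)) (by simp [add_comm])
    refine ⟨e (((r / 2 : ℝ) : ℂ) • u), ?_⟩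
    change (T (((r / 2 : ℝ) : ℂ) • u) + y) + star (T (((r / 2 : ℝ) : ℂ) • u) + y) ∈ D
    rw [star_add, ← hT_star, star_smul, hu, Complex.star_def, Complex.conj_ofReal, map_smul]
    convert hr using 1
    have : (r : ℂ) = ((r / 2 : ℝ) : ℂ) + ((r / 2 : ℝ) : ℂ) := by push_cast; ring
    rw [this, add_smul]
    abel)
  have hgT : ∀ x, g (T x) = (s x).re := fun x => (hgf (e x)).trans (hf x)
  refine ⟨Module.Dual.extendRCLike g, fun x => ?_, fun x hx => ?_⟩
  · rw [Module.Dual.extendRCLike_apply, ← map_smul, hgT, hgT, map_smul]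
    apply Complex.ext <;> simp
  · have hx' := hD_star x hx
    have h0 : 0 ≤ g x := hgP x (by
      change x + star x ∈ D
      rw [hx']
      exact hD_add _ hx _ hx)
    have hI : ∀ c : ℂ, star c = -c → 0 ≤ g (c • x) := fun c hc => hgP _ (by
      change c • x + star (c • x) ∈ D
      rw [star_smul, hx', hc, neg_smul, add_neg_cancel]
      exact hD_zero)
    have h1 := hI Complex.I (by simp)
    have h2 := hI (-Complex.I) (by simp)
    rw [neg_smul, map_neg] at h2
    have h3 : g (Complex.I • x) = 0 := by linarith
    rw [Module.Dual.extendRCLike_apply]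
    simp [h3, h0]

open Matrix in
/-- A complex matrix whose quadratic form is nonnegative is positive semidefinite. -/
lemma Matrix.posSemidef_of_dotProduct_mulVec_nonneg {n : Type*} [Fintype n]
    {M : Matrix n n ℂ} (h : ∀ x : n → ℂ, 0 ≤ star x ⬝ᵥ (M *ᵥ x)) : M.PosSemidef := by
  classical
  refine Matrix.posSemidef_iff_dotProduct_mulVec.2 ⟨?_, h⟩
  rw [← Matrix.isSymmetric_toEuclideanLin_iff, LinearMap.isSymmetric_iff_inner_map_self_real]
  intro v
  have hv : inner ℂ v (toEuclideanLin M v) = star v.ofLp ⬝ᵥ (M *ᵥ v.ofLp) := by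
    rw [EuclideanSpace.inner_eq_star_dotProduct, dotProduct_comm]
    rfl
  rw [inner_conj_symm, ← inner_conj_symm (toEuclideanLin M v) v, hv]
  exact (IsSelfAdjoint.of_nonneg (h v.ofLp)).star_eq.symm

namespace IsKAOU

variable {V : Type u} [AddCommGroup V] [Module ℂ V] [StarAddMonoid V]
  {k : ℕ} {C : Set (Matrix (Fin k) (Fin k) V)} {e : V}

lemma unitMat_mem (h : IsKAOU k C e) : unitMat k e ∈ C := by
  obtain ⟨r, hr, hx⟩ := h.orderUnit 0 (star_zero _)
  have := h.smul_mem r⁻¹ (by positivity) _ hx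
  rw [sub_zero, smul_smul] at this
  rw [← one_smul ℂ (unitMat k e)]
  convert this using 2
  have : (r : ℂ) ≠ 0 := by exact_mod_cast hr.ne'
  push_cast
  field_simp

lemma exists_eq_sub (h : IsKAOU k C e) (x : Matrix (Fin k) (Fin k) V) (hx : star x = x) :
    ∃ a ∈ C, ∃ b ∈ C, x = a - b := by
  obtain ⟨r, hr, hx⟩ := h.orderUnit x hx
  exact ⟨_, h.smul_mem r hr.le _ h.unitMat_mem, _, hx, by abel⟩

end IsKAOU

/-- The functional on `M_k(V)` associated with a linear map `V → M_k(ℂ)`. -/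
def matFunctional {V : Type*} [AddCommGroup V] [Module ℂ V] {k : ℕ}
    (φ : V →ₗ[ℂ] Matrix (Fin k) (Fin k) ℂ) : Matrix (Fin k) (Fin k) V →ₗ[ℂ] ℂ :=
  ∑ i, ∑ j, Matrix.entryLinearMap ℂ ℂ i j ∘ₗ φ ∘ₗ Matrix.entryLinearMap ℂ V i j

/-- The linear map `V → M_k(ℂ)` associated with a functional on `M_k(V)`. -/
def ofMatFunctional {V : Type*} [AddCommGroup V] [Module ℂ V] {k : ℕ}
    (G : Matrix (Fin k) (Fin k) V →ₗ[ℂ] ℂ) : V →ₗ[ℂ] Matrix (Fin k) (Fin k) ℂ where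
  toFun v := Matrix.of fun i j => G (Matrix.single i j v)
  map_add' v w := by ext i j; simp [Matrix.single_add]
  map_smul' c v := by ext i j; simp [← Matrix.smul_single]

section matFunctional

variable {V : Type*} [AddCommGroup V] [Module ℂ V] {k : ℕ}

lemma matFunctional_apply (φ : V →ₗ[ℂ] Matrix (Fin k) (Fin k) ℂ) (x : Matrix (Fin k) (Fin k) V) :
    matFunctional φ x = ∑ i, ∑ j, φ (x i j) i j := by
  simp [matFunctional, LinearMap.sum_apply]

lemma matFunctional_single (φ : V →ₗ[ℂ] Matrix (Fin k) (Fin k) ℂ) (i j : Fin k) (v : V) :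
    matFunctional φ (Matrix.single i j v) = φ v i j := by
  rw [matFunctional_apply, Finset.sum_eq_single i, Finset.sum_eq_single j]
  · simp
  · intro b _ hb
    rw [Matrix.single_apply_of_ne _ _ _ _ _ (by tauto)]; simp
  · simp
  · intro b _ hb
    refine Finset.sum_eq_zero fun c _ => ?_
    rw [Matrix.single_apply_of_ne _ _ _ _ _ (by tauto)]; simp
  · simp

lemma matFunctional_nonneg (φ : V →ₗ[ℂ] Matrix (Fin k) (Fin k) ℂ) (x : Matrix (Fin k) (Fin k) V)
    (h : (flattenM (x.map φ)).PosSemidef) : 0 ≤ matFunctional φ x := by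
  have := (Matrix.posSemidef_iff_dotProduct_mulVec.1 h).2
    (fun p => if p.1 = p.2 then 1 else 0)
  rw [matFunctional_apply]
  convert this using 1
  simp [dotProduct, Matrix.mulVec, Fintype.sum_prod_type, flattenM, apply_ite]

open Matrix in
lemma ofMatFunctional_quadratic (G : Matrix (Fin k) (Fin k) V →ₗ[ℂ] ℂ)
    (x : Matrix (Fin k) (Fin k) V) (v : Fin k × Fin k → ℂ) :
    star v ⬝ᵥ (flattenM (x.map (ofMatFunctional G)) *ᵥ v) =
      G (conjAct (Matrix.of fun p i => v (p, i)) x) := by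
  have h : conjAct (Matrix.of fun p i => v (p, i)) x =
      ∑ p, ∑ i, ∑ q, ∑ j, (conj (v (p, i)) * v (q, j)) • Matrix.single i j (x p q) := by
    ext a b
    simp [conjAct, Matrix.sum_apply, Matrix.single_apply, ite_and]
  rw [h]
  simp only [map_sum, map_smul, dotProduct, Matrix.mulVec, Fintype.sum_prod_type, Finset.mul_sum]
  refine Finset.sum_congr rfl fun p _ => Finset.sum_congr rfl fun i _ =>
    Finset.sum_congr rfl fun q _ => Finset.sum_congr rfl fun j _ => ?_
  simp [flattenM, ofMatFunctional]
  ring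

end matFunctional

/-- `M_k(ℂ)` is injective in the category of `k`-AOU spaces: every unital
`k`-positive map `φ : V → M_k(ℂ)` extends along any unital `k`-order embedding `ι : V → W`
of `k`-AOU spaces. -/
theorem stmt_8 (k : ℕ) (hk : 0 < k)
    (A : KAOUData.{u} k) (B : KAOUData.{v} k) (hA : A.IsK) (hB : B.IsK)
    (ι : A.carrier →ₗ[ℂ] B.carrier) (hι : UKOrderEmb A B ι)
    (φ : A.carrier →ₗ[ℂ] (MkData k).carrier) (hφ : UKPos A (MkData k) φ) :
    ∃ ψ : B.carrier →ₗ[ℂ] (MkData k).carrier,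
      UKPos B (MkData k) ψ ∧ ψ.comp ι = φ := by
  obtain ⟨⟨hι_unit, hι_pos⟩, hι_inj, hι_emb⟩ := hι
  obtain ⟨hφ_unit, hφ_pos⟩ := hφ
  let φ' : A.carrier →ₗ[ℂ] Matrix (Fin k) (Fin k) ℂ := φ
  have hs : ∀ x ∈ A.cone, 0 ≤ matFunctional φ' x := fun x hx =>
    matFunctional_nonneg φ' x (hφ_pos x hx)
  have hu : ι.mapMatrix (unitMat k A.unit) = unitMat k B.unit := by
    ext i j
    simp [unitMat, apply_ite ι, hι_unit]
  obtain ⟨G, hG, hG_pos⟩ := exists_positive_extension (C := A.cone) (D := B.cone)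
    (u := unitMat k A.unit) (hA.herm _ hA.unitMat_mem) hB.herm hB.add_mem hB.smul_mem
    (ι.mapMatrix) (fun x y h => Matrix.map_injective hι_inj h)
    (LinearMap.map_star_of_cone hA.exists_eq_sub _ fun x hx => hB.herm _ (hι_pos x hx))
    hι_emb
    (fun y hy => by
      rw [hu]
      obtain ⟨r, -, hr⟩ := hB.orderUnit y hy
      exact ⟨r, hr⟩)
    (matFunctional φ')
    (LinearMap.map_star_of_cone hA.exists_eq_sub _ fun x hx =>
      (IsSelfAdjoint.of_nonneg (hs x hx)).star_eq)
    hs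
  have hext : (ofMatFunctional G).comp ι = φ' := by
    ext a i j
    change G (Matrix.single i j (ι a)) = φ' a i j
    rw [← matFunctional_single, ← hG]
    congr 1
    exact (Matrix.map_single i j a ι).symm
  refine ⟨ofMatFunctional G, ⟨?_, fun x hx => ?_⟩, hext⟩
  · rw [← hι_unit, ← hφ_unit]
    exact LinearMap.congr_fun hext A.unit
  · refine Matrix.posSemidef_of_dotProduct_mulVec_nonneg fun v => ?_
    have h := hG_pos _ (hB.compat (Matrix.of fun p i => v (p, i)) _ hx)
    rwa [← ofMatFunctional_quadratic] at h
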